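/- The generalized hermitian unital H(C|R) contains no O'Nan configuration: there do not exist four distinct blocks of H(C|R) and six distinct points of H such that each of the four blocks contains exactly three of the six points and each of the six points lies on exactly two of the four blocks. -/

import Mathlib

noncomputable section

/-- A line of the projective plane `PG(2,C)`: the zero set of a nonzero linear form. -/
def IsLine (C : Type*) [Field C] (ℓ : Set (Projectivization C (Fin 3 → C))) : Prop :=
  ∃ f : (Fin 3 → C) →ₗ[C] C, f ≠ 0 ∧ ℓ = {P : Projectivization C (Fin 3 → C) | f P.rep = 0}

/-- The point set of the generalized hermitian unital `H(C|R)`: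
points `[X,Y,Z]` with `σ(X)·Y + σ(Z)·Z ∈ εR`. -/
def hermSet {C : Type*} [Field C] (R : Subfield C) (σ : C →+* C) (ε : C) :
    Set (Projectivization C (Fin 3 → C)) :=
  {P | ∃ v : Fin 3 → C, ∃ hv : v ≠ 0, P = Projectivization.mk C v hv ∧
        ∃ r ∈ R, σ (v 0) * v 1 + σ (v 2) * v 2 = ε * r}

/-- A block of `H(C|R)`: the trace of a line meeting the point set in at least two points. -/
def IsHermBlock {C : Type*} [Field C] (R : Subfield C) (σ : C →+* C) (ε : C)
    (B : Set (Projectivization C (Fin 3 → C))) : Prop :=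
  ∃ ℓ, IsLine C ℓ ∧ (hermSet R σ ε ∩ ℓ).Nontrivial ∧ B = hermSet R σ ε ∩ ℓ

/-- An O'Nan configuration with points taken from `H` and blocks taken from `L`. -/
def HasONanConfig {P : Type*} (H : Set P) (L : Set (Set P)) : Prop :=
  ∃ (B : Fin 4 → Set P) (p : Fin 6 → P),
    Function.Injective B ∧ Function.Injective p ∧
    (∀ i, B i ∈ L) ∧ (∀ j, p j ∈ H) ∧
    (∀ i, Nat.card {j : Fin 6 // p j ∈ B i} = 3) ∧
    (∀ j, Nat.card {i : Fin 4 // p j ∈ B i} = 2)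

/-- The sesquilinear map `(v, w) ↦ σ(X)Y' + σ(Z)Z'` underlying the generalized hermitian unital. -/
def sesq {C : Type*} [Field C] (σ : C →+* C) (v w : Fin 3 → C) : C :=
  σ (v 0) * w 1 + σ (v 2) * w 2

section Sesq

variable {C : Type*} [Field C] (σ : C →+* C)

lemma sesq_add_left (u v w : Fin 3 → C) : sesq σ (u + v) w = sesq σ u w + sesq σ v w := by
  simp [sesq]; ring

lemma sesq_add_right (u v w : Fin 3 → C) : sesq σ u (v + w) = sesq σ u v + sesq σ u w := by
  simp [sesq]; ring

lemma sesq_smul_left (c : C) (v w : Fin 3 → C) : sesq σ (c • v) w = σ c * sesq σ v w := by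
  simp [sesq]; ring

lemma sesq_smul_right (c : C) (v w : Fin 3 → C) : sesq σ v (c • w) = c * sesq σ v w := by
  simp [sesq]; ring

lemma sesq_sub_self (v w : Fin 3 → C) :
    sesq σ (v - w) (v - w) = sesq σ v v + sesq σ w w - (sesq σ v w + sesq σ w v) := by
  simp [sesq]; ring

end Sesq

section QuadraticExtension

variable {C : Type*} [Field C] {R : Subfield C} {ε t d : C} {σ : C →+* C}

lemma exists_add_mul_of_finrank_eq_two (hrank : Module.finrank R C = 2) (hε : ε ∉ R) :
    ∃ φ ψ : C →ₗ[R] R, (∀ c : C, c = φ c + ε * ψ c) ∧ φ 1 = 1 ∧ φ ε = 0 := by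
  have hli : LinearIndependent R ![(1 : C), ε] := by
    rw [LinearIndependent.pair_iff]
    intro a b hab
    simp only [Subfield.smul_def, smul_eq_mul, mul_one] at hab
    have hb : b = 0 := by
      by_contra hb
      apply hε
      have hb' : (b : C) ≠ 0 := by simpa using hb
      have : ε = ((-a / b : R) : C) := by
        push_cast
        field_simp
        linear_combination hab
      rw [this]
      exact SetLike.coe_mem _
    subst hb
    simpa using hab
  let e := basisOfLinearIndependentOfCardEqFinrank hli (by simp [hrank])
  have h0 : e 0 = 1 := by simp [e]
  have h1 : e 1 = ε := by simp [e]
  refine ⟨e.coord 0, e.coord 1, fun c => ?_, ?_, ?_⟩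
  · have := e.sum_repr c
    rw [Fin.sum_univ_two, h0, h1] at this
    simp only [Subfield.smul_def, smul_eq_mul, mul_one] at this
    simp only [Module.Basis.coord_apply]
    rw [mul_comm ε]
    exact this.symm
  · rw [← h0]; simp
  · rw [← h1]; simp

lemma map_mul_coe (φ : C →ₗ[R] R) (r : R) (c : C) : φ (r * c) = r * φ c := by
  simpa [Subfield.smul_def] using φ.map_smul r c

/-- The norm of `C|R` takes values in `R`. -/
lemma map_mul_self_mem (hrank : Module.finrank R C = 2) (hε : ε ∉ R) (ht : t ∈ R) (hd : d ∈ R)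
    (hmin : ε ^ 2 - t * ε + d = 0) (hσR : ∀ r ∈ R, σ r = r) (hσε : σ ε = t - ε) (c : C) :
    σ c * c ∈ R := by
  obtain ⟨φ, ψ, h, -, -⟩ := exists_add_mul_of_finrank_eq_two hrank hε
  obtain ⟨a, b, hc⟩ : ∃ a b : R, c = a + ε * b := ⟨φ c, ψ c, h c⟩
  have : σ c * c = a * a + t * a * b + d * b * b := by
    rw [hc, map_add, map_mul, hσR _ a.2, hσR _ b.2, hσε]
    linear_combination (-(b : C) * b) * hmin
  rw [this]
  exact R.add_mem (R.add_mem (R.mul_mem a.2 a.2) (R.mul_mem (R.mul_mem ht a.2) b.2))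
    (R.mul_mem (R.mul_mem hd b.2) b.2)

/-- A vector that is singular and orthogonal to everything vanishes. -/
lemma eq_zero_of_singular_of_radical {φ : C →ₗ[R] R} (hφ1 : φ 1 = 1)
    (hN : ∀ c, σ c * c ∈ R) {u : Fin 3 → C} (hq : φ (sesq σ u u) = 0)
    (hB : ∀ w, φ (sesq σ u w + sesq σ w u) = 0) : u = 0 := by
  have h0 : u 0 = 0 := by
    by_contra h
    have := hB ![0, (σ (u 0))⁻¹, 0]
    have h' : σ (u 0) ≠ 0 := by simpa using h
    simp [sesq, h', hφ1] at this
  have h1 : u 1 = 0 := by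
    by_contra h
    have := hB ![u 1, 0, 0]
    have hm := map_mul_coe φ ⟨_, hN (u 1)⟩ 1
    simp only [hφ1, mul_one] at hm
    simp only [sesq, Matrix.cons_val, mul_zero, add_zero, h0, zero_add, map_zero, zero_mul,
      hm] at this
    simpa [h] using congrArg Subtype.val this
  have h2 : u 2 = 0 := by
    have h3 := map_mul_coe φ ⟨_, hN (u 2)⟩ 1
    simp only [sesq, h0, map_zero, zero_mul, zero_add] at hq
    rw [hφ1, mul_one, mul_one, hq] at h3
    simpa using congrArg (Subtype.val) h3.symm
  ext i
  fin_cases i <;> assumption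

/-- The value at `c = a + ε b` of the polar form is determined by its values at `1` and `ε`. -/
lemma map_polar_eq (hσR : ∀ r ∈ R, σ r = r) (φ : C →ₗ[R] R) {v w : Fin 3 → C}
    (h : φ (sesq σ v w + sesq σ w v) = 0) (a b : R) :
    φ (sesq σ v (((a : C) + ε * b) • w) + sesq σ (((a : C) + ε * b) • w) v) =
      b * φ (ε * sesq σ v w + σ ε * sesq σ w v) := by
  have : sesq σ v (((a : C) + ε * b) • w) + sesq σ (((a : C) + ε * b) • w) v =
      a * (sesq σ v w + sesq σ w v) + b * (ε * sesq σ v w + σ ε * sesq σ w v) := by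
    rw [sesq_smul_left, sesq_smul_right, map_add, map_mul, hσR _ a.2, hσR _ b.2]
    ring
  rw [this, map_add, map_mul_coe, map_mul_coe, h, mul_zero, zero_add]

lemma map_polar_swap (ht : t ∈ R) (hσε : σ ε = t - ε) (φ : C →ₗ[R] R) {v w : Fin 3 → C}
    (h : φ (sesq σ v w + sesq σ w v) = 0) :
    φ (ε * sesq σ w v + σ ε * sesq σ v w) = -φ (ε * sesq σ v w + σ ε * sesq σ w v) := by
  have h1 := map_mul_coe φ ⟨t, ht⟩ (sesq σ v w + sesq σ w v)
  rw [h, mul_zero] at h1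
  rw [eq_neg_iff_add_eq_zero, ← map_add, ← h1, hσε]
  congr 1
  ring

lemma map_polar_self (hN : ∀ c, σ c * c ∈ R) (φ : C →ₗ[R] R) {v : Fin 3 → C}
    (h : φ (sesq σ v v) = 0) (c : C) : φ (sesq σ v (c • v) + sesq σ (c • v) v) = 0 := by
  have key : sesq σ v (c • v) + sesq σ (c • v) v =
      (σ (1 + c) * (1 + c)) * sesq σ v v - sesq σ v v - (σ c * c) * sesq σ v v := by
    rw [sesq_smul_left, sesq_smul_right, map_add, map_one]
    ring
  have h1 := map_mul_coe φ ⟨_, hN (1 + c)⟩ (sesq σ v v)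
  have h2 := map_mul_coe φ ⟨_, hN c⟩ (sesq σ v v)
  rw [h, mul_zero] at h1 h2
  rw [key, map_sub, map_sub, h1, h2, h]
  simp

/-- Singular linearly independent vectors `v 0, v 1, v 2` cannot have singular differences. -/
lemma false_of_singular_triangle (ht : t ∈ R) (hσR : ∀ r ∈ R, σ r = r) (hσε : σ ε = t - ε)
    (hN : ∀ c, σ c * c ∈ R) {φ ψ : C →ₗ[R] R} (hφψ : ∀ c : C, c = φ c + ε * ψ c)
    (hφ1 : φ 1 = 1) {v : Fin 3 → Fin 3 → C} (hli : LinearIndependent C v)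
    (hv : ∀ i, φ (sesq σ (v i) (v i)) = 0)
    (hsub : ∀ i j, φ (sesq σ (v i - v j) (v i - v j)) = 0) : False := by
  have hpol : ∀ i j, φ (sesq σ (v i) (v j) + sesq σ (v j) (v i)) = 0 := fun i j => by
    have := hsub i j
    rwa [sesq_sub_self, map_sub, map_add, hv, hv, add_zero, zero_sub, neg_eq_zero] at this
  obtain ⟨l, hl⟩ : ∃ l : Fin 3 → Fin 3 → R,
      ∀ i j, l i j = φ (ε * sesq σ (v i) (v j) + σ ε * sesq σ (v j) (v i)) := ⟨_, fun _ _ => rfl⟩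
  have hswap : ∀ i j, l j i = -l i j := fun i j => by
    rw [hl, hl]; exact map_polar_swap ht hσε φ (hpol i j)
  have hpolar : ∀ i j c, φ (sesq σ (v i) (c • v j) + sesq σ (c • v j) (v i)) = ψ c * l i j := by
    intro i j c
    rw [hl, ← map_polar_eq hσR φ (hpol i j) (φ c) (ψ c), ← hφψ c]
  have hself : ∀ i c, ψ c * l i i = 0 := fun i c => by
    rw [← hpolar]; exact map_polar_self hN φ (hv i) c
  have hlc : ∀ (r : Fin 3 → R) w, φ (sesq σ (∑ i, (r i : C) • v i) w +
      sesq σ w (∑ i, (r i : C) • v i)) = ∑ i, r i * φ (sesq σ (v i) w + sesq σ w (v i)) := by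
    intro r w
    simp only [Fin.sum_univ_three, ← map_mul_coe, ← map_add, sesq_add_left, sesq_add_right,
      sesq_smul_left, sesq_smul_right, hσR _ (r _).2]
    congr 1
    ring
  have hspan : ∀ w, ∃ c : Fin 3 → C, w = ∑ j, c j • v j := fun w => by
    have htop := hli.span_eq_top_of_card_eq_finrank (by simp)
    have hw : w ∈ Submodule.span C (Set.range v) := htop ▸ Submodule.mem_top
    obtain ⟨c, hc⟩ := (Submodule.mem_span_range_iff_exists_fun C).1 hw
    exact ⟨c, hc.symm⟩
  have hrad : ∀ r : Fin 3 → R, (∀ j c, ∑ i, r i * (ψ c * l i j) = 0) → ∀ i, r i = 0 := by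
    intro r hr
    have hu : ∑ i, (r i : C) • v i = 0 := by
      apply eq_zero_of_singular_of_radical hφ1 hN
      · have : sesq σ (∑ i, (r i : C) • v i) (∑ i, (r i : C) • v i) =
            (r 0 : C) * ((r 0 : C) * sesq σ (v 0) (v 0)) +
            (r 1 : C) * ((r 1 : C) * sesq σ (v 1) (v 1)) +
            (r 2 : C) * ((r 2 : C) * sesq σ (v 2) (v 2)) +
            (r 0 : C) * ((r 1 : C) * (sesq σ (v 0) (v 1) + sesq σ (v 1) (v 0))) +
            (r 0 : C) * ((r 2 : C) * (sesq σ (v 0) (v 2) + sesq σ (v 2) (v 0))) +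
            (r 1 : C) * ((r 2 : C) * (sesq σ (v 1) (v 2) + sesq σ (v 2) (v 1))) := by
          simp only [Fin.sum_univ_three, sesq_add_left, sesq_add_right,
            sesq_smul_left, sesq_smul_right, hσR _ (r _).2]
          ring
        rw [this]
        simp only [map_add φ (_ * _), map_add φ (_ + _) (_ * _), map_mul_coe, hv, hpol, mul_zero,
          add_zero]
      · intro w
        obtain ⟨c, rfl⟩ := hspan w
        have h1 : ∀ j, φ (sesq σ (∑ i, (r i : C) • v i) (c j • v j) +
            sesq σ (c j • v j) (∑ i, (r i : C) • v i)) = 0 := fun j => by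
          rw [hlc]; simp only [hpolar]; exact hr j (c j)
        have h2 := congrArg₂ (· + ·) (congrArg₂ (· + ·) (h1 0) (h1 1)) (h1 2)
        simp only [← map_add, add_zero] at h2
        rw [← h2]
        congr 1
        rw [Fin.sum_univ_three (fun j => c j • v j)]
        simp only [sesq_add_left σ _ _ (∑ i, (r i : C) • v i),
          sesq_add_right σ (∑ i, (r i : C) • v i)]
        ring
    intro i
    simpa using Fintype.linearIndependent_iff.1 hli _ hu i
  have hz := hrad ![l 1 2, l 2 0, l 0 1] (by
    intro j c
    rw [Fin.sum_univ_three]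
    simp only [Matrix.cons_val]
    fin_cases j
    · have h1 := hself 0 c
      have h2 := hswap 0 1
      simp only [Fin.zero_eta]
      linear_combination (l 1 2) * h1 + (ψ c * l 2 0) * h2
    · have h1 := hself 1 c
      have h2 := hswap 1 2
      simp only [Fin.mk_one]
      linear_combination (l 2 0) * h1 + (ψ c * l 0 1) * h2
    · have h1 := hself 2 c
      have h2 := hswap 2 0
      simp only [Fin.reduceFinMk]
      linear_combination (l 0 1) * h1 + (ψ c * l 1 2) * h2)
  have h12 : l 1 2 = 0 := hz 0
  have h20 : l 2 0 = 0 := hz 1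
  have h01 : l 0 1 = 0 := hz 2
  have h02 : l 0 2 = 0 := by rw [hswap 2 0, h20, neg_zero]
  have := hrad ![1, 0, 0] (by
    intro j c
    rw [Fin.sum_univ_three]
    simp only [Matrix.cons_val, zero_mul, add_zero, one_mul]
    fin_cases j
    · exact hself 0 c
    · simp [h01]
    · simp [h02]) 0
  simp at this

lemma map_sesq_rep_eq_zero (hN : ∀ c, σ c * c ∈ R)
    {φ : C →ₗ[R] R} (hφε : φ ε = 0) {P : Projectivization C (Fin 3 → C)}
    (hP : P ∈ hermSet R σ ε) : φ (sesq σ P.rep P.rep) = 0 := by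
  obtain ⟨v, hv, rfl, r, hr, h⟩ := hP
  obtain ⟨a, ha⟩ := Projectivization.exists_smul_eq_mk_rep C v hv
  have h1 := map_mul_coe φ ⟨_, hN a⟩ (r * ε)
  have h2 := map_mul_coe φ ⟨r, hr⟩ ε
  rw [hφε, mul_zero] at h2
  rw [h2, mul_zero] at h1
  rw [← ha, ← h1, Units.smul_def, sesq_smul_left, sesq_smul_right]
  congr 1
  have h' : sesq σ v v = ε * r := h
  rw [h']
  ring

lemma map_sesq_smul_self (hN : ∀ c, σ c * c ∈ R) {φ : C →ₗ[R] R} {v : Fin 3 → C}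
    (h : φ (sesq σ v v) = 0) (c : C) : φ (sesq σ (c • v) (c • v)) = 0 := by
  have h1 := map_mul_coe φ ⟨_, hN c⟩ (sesq σ v v)
  rw [h, mul_zero] at h1
  rw [← h1, sesq_smul_left, sesq_smul_right, ← mul_assoc]

end QuadraticExtension

section Plane

variable {C : Type*} [Field C]

lemma linearIndependent_of_dual_triangle {f : Fin 3 → ((Fin 3 → C) →ₗ[C] C)}
    {v : Fin 3 → Fin 3 → C} (hne : ∀ i, f i (v i) ≠ 0) (h : ∀ i j, i ≠ j → f i (v j) = 0) :
    LinearIndependent C v := by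
  rw [Fintype.linearIndependent_iff]
  intro g hg i
  have := congrArg (f i) hg
  rw [map_sum, Finset.sum_eq_single i (fun j _ hj => by simp [h i j hj.symm]) (by simp)] at this
  simpa [hne i] using this

/-- Two linear forms vanishing at two distinct points define the same line. -/
lemma ker_eq_ker_of_two_points {f g : (Fin 3 → C) →ₗ[C] C} (hf : f ≠ 0) (hg : g ≠ 0)
    {P Q : Projectivization C (Fin 3 → C)} (hPQ : P ≠ Q) (hfP : f P.rep = 0) (hfQ : f Q.rep = 0)
    (hgP : g P.rep = 0) (hgQ : g Q.rep = 0) : LinearMap.ker f = LinearMap.ker g := by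
  have hli : LinearIndependent C ![P.rep, Q.rep] := by
    have := (Projectivization.independent_pair_iff_ne P Q).2 hPQ
    rw [Projectivization.independent_iff] at this
    rw [show ![P.rep, Q.rep] = Projectivization.rep ∘ ![P, Q] by ext i; fin_cases i <;> rfl]
    exact this
  have hspan : Module.finrank C (Submodule.span C (Set.range ![P.rep, Q.rep])) = 2 := by
    simpa using finrank_span_eq_card hli
  have key : ∀ f : (Fin 3 → C) →ₗ[C] C, f ≠ 0 → f P.rep = 0 → f Q.rep = 0 →
      Submodule.span C (Set.range ![P.rep, Q.rep]) = LinearMap.ker f := by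
    intro f hf hP hQ
    apply Submodule.eq_of_le_of_finrank_eq
    · rw [Submodule.span_le]
      rintro _ ⟨i, rfl⟩
      fin_cases i <;> simpa
    · have h1 := f.finrank_range_add_finrank_ker
      rw [LinearMap.range_eq_top.2 (LinearMap.surjective hf)] at h1
      simp at h1
      omega
  rw [← key f hf hfP hfQ, key g hg hgP hgQ]

/-- If the lines `f i` bound the triangle `v` and `g` meets none of its vertices, a point
of the intersection of `f k` and `g` is proportional to a difference of normalized vertices. -/
lemma exists_smul_sub_of_dual_triangle {f : Fin 3 → ((Fin 3 → C) →ₗ[C] C)}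
    {v : Fin 3 → Fin 3 → C} (hne : ∀ i, f i (v i) ≠ 0) (h : ∀ i j, i ≠ j → f i (v j) = 0)
    {g : (Fin 3 → C) →ₗ[C] C} (hg : ∀ i, g (v i) = 1) {i j k : Fin 3} (hij : i ≠ j) (hik : i ≠ k)
    (hjk : j ≠ k) {w : Fin 3 → C} (hw : w ≠ 0) (hfw : f k w = 0) (hgw : g w = 0) :
    ∃ c : C, v i - v j = c • w := by
  have hli := linearIndependent_of_dual_triangle hne h
  have htop := hli.span_eq_top_of_card_eq_finrank (by simp)
  have hmem : w ∈ Submodule.span C (Set.range v) := htop ▸ Submodule.mem_top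
  obtain ⟨c, hc⟩ := (Submodule.mem_span_range_iff_exists_fun C).1 hmem
  have huniv : (Finset.univ : Finset (Fin 3)) = {i, j, k} := by
    clear * - hij hik hjk
    decide +revert
  rw [huniv, Finset.sum_insert (by simp [hij, hik]), Finset.sum_insert (by simp [hjk]),
    Finset.sum_singleton] at hc
  have hk : c k = 0 := by
    rw [← hc] at hfw
    simpa [h k i hik.symm, h k j hjk.symm, hne k] using hfw
  have hj : c j = -c i := by
    rw [← hc] at hgw
    simp only [map_add, map_smul, hg, hk, smul_eq_mul, mul_one, add_zero] at hgw
    linear_combination hgw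
  have hw' : w = c i • (v i - v j) := by
    rw [← hc, hk, hj]
    module
  have hi : c i ≠ 0 := by
    rintro h0
    exact hw (by rw [hw', h0, zero_smul])
  exact ⟨(c i)⁻¹, by rw [hw', smul_smul, inv_mul_cancel₀ hi, one_smul]⟩

end Plane

/-- In an O'Nan configuration whose blocks pairwise share at most one point, every two blocks share
one of the six points, which lies on no other block. -/
lemma exists_vertex {P : Type*} {B : Fin 4 → Set P} {p : Fin 6 → P}
    (hp : ∀ j, Nat.card {i : Fin 4 // p j ∈ B i} = 2)
    (hB : ∀ i k, i ≠ k → ∀ j j', p j ∈ B i → p j ∈ B k → p j' ∈ B i → p j' ∈ B k → j = j')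
    {i k : Fin 4} (hik : i ≠ k) : ∃ j, ∀ m, p j ∈ B m ↔ m = i ∨ m = k := by
  classical
  let s : Fin 6 → Finset (Fin 4) := fun j => {i | p j ∈ B i}
  have hs : ∀ j, (s j).card = 2 := fun j => by
    rw [← hp j, Nat.card_eq_fintype_card, Fintype.card_subtype]
  have hinj : Function.Injective s := by
    intro j j' h
    obtain ⟨a, b, hab, hsab⟩ := Finset.card_eq_two.1 (hs j)
    have h1 : ∀ m, p j ∈ B m ↔ m = a ∨ m = b := fun m => by
      simpa [s] using Finset.ext_iff.1 hsab m
    have h2 : ∀ m, p j' ∈ B m ↔ m = a ∨ m = b := fun m => by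
      simpa [s] using Finset.ext_iff.1 (h.symm.trans hsab) m
    exact hB a b hab j j' (by simp [h1]) (by simp [h1]) (by simp [h2]) (by simp [h2])
  have himage : Finset.univ.image s = Finset.powersetCard 2 Finset.univ := by
    apply Finset.eq_of_subset_of_card_le
    · intro x hx
      obtain ⟨j, -, rfl⟩ := Finset.mem_image.1 hx
      simp [Finset.mem_powersetCard, hs]
    · rw [Finset.card_image_of_injective _ hinj, Finset.card_powersetCard]
      simp [Nat.choose]
  have hmem : ({i, k} : Finset (Fin 4)) ∈ Finset.univ.image s := by
    rw [himage]
    simp [Finset.mem_powersetCard, Finset.card_pair hik]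
  obtain ⟨j, -, hj⟩ := Finset.mem_image.1 hmem
  exact ⟨j, fun m => by simpa [s] using Finset.ext_iff.1 hj m⟩

/-- The generalized hermitian unital `H(C|R)` contains no O'Nan configuration. -/
theorem no_ONan_config_in_generalized_hermitian_unital
    {C : Type*} [Field C] (R : Subfield C) (ε t d : C) (σ : C →+* C)
    (hrank : Module.finrank R C = 2)
    (hε : ε ∉ R) (ht : t ∈ R) (hd : d ∈ R)
    (hmin : ε ^ 2 - t * ε + d = 0)
    (hσR : ∀ r ∈ R, σ r = r) (hσε : σ ε = t - ε) :
    ¬ HasONanConfig (hermSet R σ ε) {B | IsHermBlock R σ ε B} := by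
  rintro ⟨B, p, hBinj, hpinj, hB, hpH, -, hp⟩
  have hN := map_mul_self_mem hrank hε ht hd hmin hσR hσε
  obtain ⟨φ, ψ, hφψ, hφ1, hφε⟩ := exists_add_mul_of_finrank_eq_two hrank hε
  have hBf : ∀ i, ∃ f : (Fin 3 → C) →ₗ[C] C, f ≠ 0 ∧
      B i = hermSet R σ ε ∩ {P : Projectivization C (Fin 3 → C) | f P.rep = 0} := by
    intro i
    obtain ⟨_, ⟨f, hf, rfl⟩, -, h⟩ := hB i
    exact ⟨f, hf, h⟩
  choose f hf hBf using hBf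
  have hmem : ∀ j i, p j ∈ B i ↔ f i (p j).rep = 0 := fun j i => by
    rw [hBf i]
    exact ⟨fun h => h.2, fun h => ⟨hpH j, h⟩⟩
  have hpair : ∀ i k, i ≠ k → ∀ j j', p j ∈ B i → p j ∈ B k → p j' ∈ B i → p j' ∈ B k →
      j = j' := by
    intro i k hik j j' h1 h2 h3 h4
    by_contra hjj
    apply hik
    apply hBinj
    have hker := ker_eq_ker_of_two_points (hf i) (hf k) (hpinj.ne hjj) ((hmem _ _).1 h1)
      ((hmem _ _).1 h3) ((hmem _ _).1 h2) ((hmem _ _).1 h4)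
    rw [hBf i, hBf k]
    congr 1
    ext Q
    simp only [Set.mem_ofPred_eq, ← LinearMap.mem_ker, hker]
  have hsing : ∀ j, φ (sesq σ (p j).rep (p j).rep) = 0 := fun j =>
    map_sesq_rep_eq_zero hN hφε (hpH j)
  have hvertex : ∀ i k : Fin 4, i ≠ k → ∃ v : Fin 3 → C, v ≠ 0 ∧ φ (sesq σ v v) = 0 ∧
      ∀ m, f m v = 0 ↔ m = i ∨ m = k := fun i k hik => by
    obtain ⟨j, hj⟩ := exists_vertex hp hpair hik
    exact ⟨(p j).rep, (p j).rep_nonzero, hsing j, fun m => by rw [← hmem, hj]⟩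
  have hnorm : ∀ i : Fin 3, ∃ v : Fin 3 → C, φ (sesq σ v v) = 0 ∧ f 3 v = 1 ∧
      ∀ m : Fin 3, f m.castSucc v = 0 ↔ m ≠ i := fun i => by
    obtain ⟨v, hv, hq, hfv⟩ := hvertex (i + 1).castSucc (i + 2).castSucc (by decide +revert)
    have h3 : f 3 v ≠ 0 := by
      rw [Ne, hfv]
      clear * -
      decide +revert
    refine ⟨(f 3 v)⁻¹ • v, map_sesq_smul_self hN hq _, by simp [h3], fun m => ?_⟩
    rw [map_smul, smul_eq_mul, mul_eq_zero, inv_eq_zero, or_iff_right h3, hfv]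
    clear * -
    decide +revert
  choose v hvq hv3 hfv using hnorm
  have hne : ∀ i : Fin 3, f i.castSucc (v i) ≠ 0 := fun i => by simp [hfv]
  have hzero : ∀ i j : Fin 3, i ≠ j → f i.castSucc (v j) = 0 := fun i j hij => by simpa [hfv]
  refine false_of_singular_triangle ht hσR hσε hN hφψ hφ1
    (linearIndependent_of_dual_triangle (f := fun i : Fin 3 => f i.castSucc) hne hzero) hvq ?_
  intro i j
  by_cases hij : i = j
  · simp [hij, sesq]
  obtain ⟨k, hik, hjk⟩ : ∃ k : Fin 3, i ≠ k ∧ j ≠ k := by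
    clear * -
    decide +revert
  obtain ⟨w, hw, hwq, hfw⟩ := hvertex k.castSucc 3 (by decide +revert)
  obtain ⟨c, hc⟩ := exists_smul_sub_of_dual_triangle (f := fun i : Fin 3 => f i.castSucc) hne hzero
    hv3 hij hik hjk hw ((hfw _).2 (Or.inl rfl)) ((hfw _).2 (Or.inr rfl))
  rw [hc]
  exact map_sesq_smul_self hN hwq c
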